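/- Let Z₀ > 0, σ > 0, T > 0, α ∈ (0,1), and for x ≥ 0 define C^Ba(x) = Z₀ σ √(x/(2π)) and C(x) = Z₀ (Φ(σ√x/2) − Φ(−σ√x/2)). Let μ be a probability measure on [0,∞) satisfying ∫ x^{3/2} dμ(x) = T^{3α/2} Γ(5/2) / Γ(3α/2 + 1). Then 0 ≤ ∫ (C^Ba(x) − C(x)) dμ(x) ≤ (T^{3α/2} Γ(5/2) / Γ(3α/2 + 1)) · (Z₀/(12√(2π))) σ³. -/

import Mathlib

open MeasureTheory Real

/-- The standard normal cumulative distribution function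
`Φ(x) = (1/√(2π)) ∫_{−∞}^x e^{−u²/2} du`. -/
noncomputable def stdNormalCDF (x : ℝ) : ℝ :=
  (Real.sqrt (2 * Real.pi))⁻¹ * ∫ u in Set.Iic x, Real.exp (-u ^ 2 / 2)

/-- At-the-money, zero-interest-rate Bachelier call price with expiry `x` and
Bachelier volatility `σ Z₀`: `C^Ba(x) = Z₀ σ √(x/(2π))`. -/
noncomputable def bachelierCall (Z₀ σ x : ℝ) : ℝ :=
  Z₀ * σ * Real.sqrt (x / (2 * Real.pi))

/-- At-the-money, zero-interest-rate Black–Scholes call price with expiry `x` and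
volatility `σ`: `C(x) = Z₀ (Φ(σ√x/2) − Φ(−σ√x/2))`. -/
noncomputable def bsCall (Z₀ σ x : ℝ) : ℝ :=
  Z₀ * (stdNormalCDF (σ * Real.sqrt x / 2) - stdNormalCDF (-(σ * Real.sqrt x / 2)))

theorem integrable_exp_neg_sq_div_two : Integrable fun u : ℝ => Real.exp (-u ^ 2 / 2) := by
  have h := integrable_exp_neg_mul_sq (b := 1 / 2) (by norm_num)
  refine h.congr (Filter.Eventually.of_forall fun u => ?_)
  simp only
  congr 1
  ring

theorem stdNormalCDF_sub_stdNormalCDF (a b : ℝ) :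
    stdNormalCDF b - stdNormalCDF a =
      (Real.sqrt (2 * Real.pi))⁻¹ * ∫ u in a..b, Real.exp (-u ^ 2 / 2) := by
  unfold stdNormalCDF
  rw [← mul_sub, intervalIntegral.integral_Iic_sub_Iic
    integrable_exp_neg_sq_div_two.integrableOn integrable_exp_neg_sq_div_two.integrableOn]

theorem integral_exp_neg_sq_div_two_le {y : ℝ} (hy : 0 ≤ y) :
    ∫ u in (-y)..y, Real.exp (-u ^ 2 / 2) ≤ 2 * y := by
  calc ∫ u in (-y)..y, Real.exp (-u ^ 2 / 2) ≤ ∫ _u in (-y)..y, (1 : ℝ) := by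
        refine intervalIntegral.integral_mono_on (by linarith)
          integrable_exp_neg_sq_div_two.intervalIntegrable (by simp) fun u _ => ?_
        rw [Real.exp_le_one_iff]
        nlinarith [sq_nonneg u]
    _ = 2 * y := by simp; ring

theorem le_integral_exp_neg_sq_div_two {y : ℝ} (hy : 0 ≤ y) :
    2 * y - y ^ 3 / 3 ≤ ∫ u in (-y)..y, Real.exp (-u ^ 2 / 2) := by
  calc 2 * y - y ^ 3 / 3 = ∫ u in (-y)..y, (1 - u ^ 2 / 2) := by
        rw [intervalIntegral.integral_sub (by simp)
          (Continuous.intervalIntegrable (by fun_prop) _ _)]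
        simp [integral_pow]
        ring
    _ ≤ ∫ u in (-y)..y, Real.exp (-u ^ 2 / 2) := by
        refine intervalIntegral.integral_mono_on (by linarith)
          (Continuous.intervalIntegrable (by fun_prop) _ _)
          integrable_exp_neg_sq_div_two.intervalIntegrable fun u _ => ?_
        linarith [Real.add_one_le_exp (-u ^ 2 / 2)]

theorem bachelierCall_sub_bsCall (Z₀ σ x : ℝ) :
    bachelierCall Z₀ σ x - bsCall Z₀ σ x =
      Z₀ / Real.sqrt (2 * Real.pi) * (2 * (σ * Real.sqrt x / 2) -
        ∫ u in (-(σ * Real.sqrt x / 2))..(σ * Real.sqrt x / 2), Real.exp (-u ^ 2 / 2)) := by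
  unfold bachelierCall bsCall
  rw [stdNormalCDF_sub_stdNormalCDF, Real.sqrt_div' x (by positivity)]
  ring

theorem bsCall_le_bachelierCall {Z₀ σ : ℝ} (hZ₀ : 0 ≤ Z₀) (hσ : 0 ≤ σ) (x : ℝ) :
    0 ≤ bachelierCall Z₀ σ x - bsCall Z₀ σ x := by
  rw [bachelierCall_sub_bsCall]
  have := integral_exp_neg_sq_div_two_le (y := σ * Real.sqrt x / 2) (by positivity)
  exact mul_nonneg (by positivity) (by linarith)

theorem bachelierCall_sub_bsCall_le {Z₀ σ x : ℝ} (hZ₀ : 0 ≤ Z₀) (hσ : 0 ≤ σ) (hx : 0 ≤ x) :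
    bachelierCall Z₀ σ x - bsCall Z₀ σ x ≤
      x ^ ((3 : ℝ) / 2) * (Z₀ / (12 * Real.sqrt (2 * Real.pi)) * σ ^ 3) := by
  have hpow : x ^ ((3 : ℝ) / 2) = Real.sqrt x ^ 3 := by
    rw [Real.sqrt_eq_rpow, ← Real.rpow_natCast, ← Real.rpow_mul hx]
    norm_num
  have hint := le_integral_exp_neg_sq_div_two (y := σ * Real.sqrt x / 2) (by positivity)
  have hcube : 0 ≤ (σ * Real.sqrt x) ^ 3 := by positivity
  rw [bachelierCall_sub_bsCall, hpow]
  calc _ ≤ Z₀ / Real.sqrt (2 * Real.pi) * ((σ * Real.sqrt x) ^ 3 / 12) := by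
        refine mul_le_mul_of_nonneg_left ?_ (by positivity)
        linarith
    _ = _ := by field_simp

/-- Subdiffusive (inverse α-stable) Schachermayer–Teichmann inequality: if the
`3/2`-moment of `μ` equals `T^{3α/2} Γ(5/2)/Γ(3α/2+1)` (the `3/2`-moment of the
inverse α-stable subordinator at time `T`), then
`0 ≤ ∫ (C^Ba − C) dμ ≤ (T^{3α/2} Γ(5/2)/Γ(3α/2+1)) · (Z₀/(12√(2π))) σ³`. -/
theorem subdiffusive_bachelier_vs_blackScholes (Z₀ σ T α : ℝ) (hZ₀ : 0 < Z₀)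
    (hσ : 0 < σ) (hT : 0 < T) (hα : α ∈ Set.Ioo (0 : ℝ) 1)
    (μ : Measure ℝ) [IsProbabilityMeasure μ] (hsupp : ∀ᵐ x ∂μ, 0 ≤ x)
    (hmom_int : Integrable (fun x => x ^ ((3 : ℝ) / 2)) μ)
    (hmom : ∫ x, x ^ ((3 : ℝ) / 2) ∂μ
      = T ^ (3 * α / 2) * Real.Gamma (5 / 2) / Real.Gamma (3 * α / 2 + 1)) :
    0 ≤ ∫ x, (bachelierCall Z₀ σ x - bsCall Z₀ σ x) ∂μ ∧
    ∫ x, (bachelierCall Z₀ σ x - bsCall Z₀ σ x) ∂μ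
      ≤ T ^ (3 * α / 2) * Real.Gamma (5 / 2) / Real.Gamma (3 * α / 2 + 1)
          * (Z₀ / (12 * Real.sqrt (2 * Real.pi)) * σ ^ 3) := by
  refine ⟨integral_nonneg fun x => bsCall_le_bachelierCall hZ₀.le hσ.le x, ?_⟩
  rw [← hmom, ← integral_mul_const]
  refine integral_mono_of_nonneg
    (Filter.Eventually.of_forall fun x => bsCall_le_bachelierCall hZ₀.le hσ.le x)
    (hmom_int.mul_const _) ?_
  filter_upwards [hsupp] with x hx
  exact bachelierCall_sub_bsCall_le hZ₀.le hσ.le hx
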